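/- (Comparison theorem.) Let K ⊂ Γ be a closed subset and let f ∈ C(Γ) satisfy f(x) < 0 for all x ∈ Γ \ K. Let u ∈ USC(Γ̄) be a viscosity subsolution of H(x, Du) = f(x) in Γ \ K and let v ∈ LSC(Γ̄) be a viscosity supersolution of H(x, Du) = 0 in Γ \ K. If u ≤ v on ∂Γ ∪ K, then u ≤ v on all of Γ̄. -/

import Mathlib

open Set Filter MeasureTheory

/-- A finite topological network embedded in `ℝ^N`, in the sense of Schieborn–Camilli:
finitely many pairwise distinct vertices `V i`, and finitely many differentiable,
non-self-intersecting parametrized curves `π j : [0, l j] → ℝ^N` (the edges), whose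
endpoints are vertices, such that each closed edge contains exactly two vertices,
two different closed edges meet in at most one point which is a vertex, and the
network is connected.  A nonempty set `IB` of boundary vertices is fixed, containing
every vertex incident to exactly one edge. -/
structure TopNetwork (N : ℕ) (I J : Type) [Fintype I] [Fintype J] where
  /-- the vertices -/
  V : I → EuclideanSpace ℝ (Fin N)
  V_inj : Function.Injective V
  /-- the lengths of the parametrizing intervals -/
  l : J → ℝ
  l_pos : ∀ j, 0 < l j
  /-- the parametrizations of the edges -/
  π : J → ℝ → EuclideanSpace ℝ (Fin N)
  π_diff : ∀ j, ∀ t ∈ Set.Icc 0 (l j), DifferentiableWithinAt ℝ (π j) (Set.Icc 0 (l j)) t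
  π_inj : ∀ j, Set.InjOn (π j) (Set.Icc 0 (l j))
  start_mem : ∀ j, ∃ i, π j 0 = V i
  end_mem : ∀ j, ∃ i, π j (l j) = V i
  edge_two_vertices : ∀ j, (π j '' Set.Icc 0 (l j) ∩ Set.range V).ncard = 2
  edges_cap_sub : ∀ j k, j ≠ k →
    π j '' Set.Icc 0 (l j) ∩ π k '' Set.Icc 0 (l k) ⊆ Set.range V
  edges_cap_card : ∀ j k, j ≠ k →
    (π j '' Set.Icc 0 (l j) ∩ π k '' Set.Icc 0 (l k)).ncard ≤ 1
  connected : ∀ i i' : I, ∃ (n : ℕ) (f : ℕ → J),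
    V i ∈ π (f 0) '' Set.Icc 0 (l (f 0)) ∧
    V i' ∈ π (f n) '' Set.Icc 0 (l (f n)) ∧
    ∀ m < n, (π (f m) '' Set.Icc 0 (l (f m)) ∩ π (f (m+1)) '' Set.Icc 0 (l (f (m+1)))).Nonempty
  /-- the indices of the boundary vertices -/
  IB : Set I
  IB_nonempty : IB.Nonempty
  deg_one_bdry : ∀ i, {j | π j 0 = V i ∨ π j (l j) = V i}.ncard = 1 → i ∈ IB

namespace TopNetwork

variable {N : ℕ} {I J : Type} [Fintype I] [Fintype J] (G : TopNetwork N I J)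

/-- the closed edge `ē_j` -/
def edgeC (j : J) : Set (EuclideanSpace ℝ (Fin N)) := G.π j '' Set.Icc 0 (G.l j)

/-- the open edge `e_j` -/
def edgeO (j : J) : Set (EuclideanSpace ℝ (Fin N)) := G.π j '' Set.Ioo 0 (G.l j)

/-- the whole network `Γ̄` -/
def Gbar : Set (EuclideanSpace ℝ (Fin N)) := ⋃ j, G.edgeC j

/-- the set `∂Γ` of boundary vertices -/
def bdry : Set (EuclideanSpace ℝ (Fin N)) := {x | ∃ i ∈ G.IB, x = G.V i}

/-- the set `Γ = Γ̄ \ ∂Γ` -/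
def Gam : Set (EuclideanSpace ℝ (Fin N)) := G.Gbar \ G.bdry

/-- the indices of the transition vertices -/
def IT : Set I := G.IBᶜ

/-- the set of edges incident to the vertex `v_i` -/
def Inc (i : I) : Set J := {j | G.π j 0 = G.V i ∨ G.π j (G.l j) = G.V i}

open Classical in
/-- the signed incidence coefficient `a_{ij}` -/
noncomputable def a (i : I) (j : J) : ℝ :=
  if G.π j 0 = G.V i then 1 else if G.π j (G.l j) = G.V i then -1 else 0

open Classical in
/-- the parameter `π_j⁻¹(v_i)` of the vertex `v_i` on an incident edge `j` -/
noncomputable def vt (i : I) (j : J) : ℝ := if G.π j 0 = G.V i then 0 else G.l j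

/-- `φ` has derivative `p` along the edge `j` (in the chart `π j`) at the parameter `t`;
at an endpoint of `[0, l j]` this is the one-sided derivative. -/
def HasEdgeDerivAt (φ : EuclideanSpace ℝ (Fin N) → ℝ) (j : J) (t p : ℝ) : Prop :=
  HasDerivWithinAt (fun s => φ (G.π j s)) p (Set.Icc 0 (G.l j)) t

/-- a Hamiltonian of eikonal type on the network -/
structure IsEikonalHamiltonian (H : J → ℝ → ℝ → ℝ) : Prop where
  cont : ∀ j, ContinuousOn (fun q : ℝ × ℝ => H j q.1 q.2)
    (Set.Icc 0 (G.l j) ×ˢ (Set.univ : Set ℝ))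
  cvx : ∀ j, ∀ t ∈ Set.Icc 0 (G.l j), ConvexOn ℝ Set.univ (H j t)
  coercive : ∀ j, ∀ t ∈ Set.Icc 0 (G.l j),
    Filter.Tendsto (H j t) (Filter.cocompact ℝ) Filter.atTop
  vertexCompat : ∀ i : I, ∀ j ∈ G.Inc i, ∀ k ∈ G.Inc i, ∀ p : ℝ,
    H j (G.vt i j) p = H k (G.vt i k) p
  vertexSymm : ∀ i : I, ∀ j ∈ G.Inc i, ∀ p : ℝ, H j (G.vt i j) p = H j (G.vt i j) (-p)

/-- viscosity subsolution of `H(x, Du) = f(x)` on `Ω ⊆ Γ` -/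
def IsSubSolOn (H : J → ℝ → ℝ → ℝ) (f u : EuclideanSpace ℝ (Fin N) → ℝ)
    (Ω : Set (EuclideanSpace ℝ (Fin N))) : Prop :=
  UpperSemicontinuousOn u G.Gbar ∧
  (∀ j : J, ∀ t ∈ Set.Ioo 0 (G.l j), G.π j t ∈ Ω →
    ∀ φ : EuclideanSpace ℝ (Fin N) → ℝ, ContinuousOn φ G.Gam →
    ∀ p : ℝ, G.HasEdgeDerivAt φ j t p →
    IsLocalMaxOn (fun y => u y - φ y) G.Gam (G.π j t) →
    H j t p ≤ f (G.π j t)) ∧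
  (∀ i ∈ G.IT, G.V i ∈ Ω →
    ∀ j ∈ G.Inc i, ∀ k ∈ G.Inc i, j ≠ k →
    ∀ φ : EuclideanSpace ℝ (Fin N) → ℝ, ContinuousOn φ G.Gam →
    ∀ pj pk : ℝ, G.HasEdgeDerivAt φ j (G.vt i j) pj → G.HasEdgeDerivAt φ k (G.vt i k) pk →
    G.a i j * pj + G.a i k * pk = 0 →
    IsLocalMaxOn (fun y => u y - φ y) G.Gam (G.V i) →
    H j (G.vt i j) pj ≤ f (G.V i))

/-- viscosity supersolution of `H(x, Du) = f(x)` on `Ω ⊆ Γ` -/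
def IsSuperSolOn (H : J → ℝ → ℝ → ℝ) (f u : EuclideanSpace ℝ (Fin N) → ℝ)
    (Ω : Set (EuclideanSpace ℝ (Fin N))) : Prop :=
  LowerSemicontinuousOn u G.Gbar ∧
  (∀ j : J, ∀ t ∈ Set.Ioo 0 (G.l j), G.π j t ∈ Ω →
    ∀ φ : EuclideanSpace ℝ (Fin N) → ℝ, ContinuousOn φ G.Gam →
    ∀ p : ℝ, G.HasEdgeDerivAt φ j t p →
    IsLocalMinOn (fun y => u y - φ y) G.Gam (G.π j t) →
    f (G.π j t) ≤ H j t p) ∧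
  (∀ i ∈ G.IT, G.V i ∈ Ω →
    ∀ j ∈ G.Inc i, ∃ k ∈ G.Inc i, k ≠ j ∧
      ∀ φ : EuclideanSpace ℝ (Fin N) → ℝ, ContinuousOn φ G.Gam →
      ∀ pj pk : ℝ, G.HasEdgeDerivAt φ j (G.vt i j) pj → G.HasEdgeDerivAt φ k (G.vt i k) pk →
      G.a i j * pj + G.a i k * pk = 0 →
      IsLocalMinOn (fun y => u y - φ y) G.Gam (G.V i) →
      f (G.V i) ≤ H j (G.vt i j) pj)

/-- viscosity solution of `H(x, Du) = f(x)` on `Ω ⊆ Γ` -/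
def IsSolOn (H : J → ℝ → ℝ → ℝ) (f u : EuclideanSpace ℝ (Fin N) → ℝ)
    (Ω : Set (EuclideanSpace ℝ (Fin N))) : Prop :=
  G.IsSubSolOn H f u Ω ∧ G.IsSuperSolOn H f u Ω

/-- a piecewise differentiable path in the network from `y` to `x`, described in the
charts: on each subinterval `[t m, t (m+1)]` of `[0, T]` the path runs inside the
closed edge `e m`, with `C¹` coordinate `g m`. -/
structure PWPath (y x : EuclideanSpace ℝ (Fin N)) where
  T : ℝ
  T_pos : 0 < T
  n : ℕ
  t : ℕ → ℝ
  t_zero : t 0 = 0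
  t_last : t (n + 1) = T
  t_mono : ∀ m ≤ n, t m < t (m + 1)
  e : ℕ → J
  g : ℕ → ℝ → ℝ
  g_mem : ∀ m ≤ n, ∀ s ∈ Set.Icc (t m) (t (m + 1)), g m s ∈ Set.Icc 0 (G.l (e m))
  g_smooth : ∀ m ≤ n, ContDiffOn ℝ 1 (g m) (Set.Icc (t m) (t (m + 1)))
  h_start : G.π (e 0) (g 0 0) = y
  h_end : G.π (e n) (g n T) = x
  h_junction : ∀ m < n, G.π (e m) (g m (t (m + 1))) = G.π (e (m + 1)) (g (m + 1) (t (m + 1)))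

/-- the path distance `d(y,x)` on the network -/
noncomputable def pdist (y x : EuclideanSpace ℝ (Fin N)) : ℝ :=
  sInf {c : ℝ | ∃ γ : G.PWPath y x,
    c = ∑ m ∈ Finset.range (γ.n + 1),
      ∫ s in (γ.t m)..(γ.t (m + 1)),
        |derivWithin (γ.g m) (Set.Icc (γ.t m) (γ.t (m + 1))) s|}

/-- `v` is an upper bound for the Legendre transform
`L^j(x,q) = sup_p (p q − H^j(x,p))` -/
def LagrangianLE (H : J → ℝ → ℝ → ℝ) (j : J) (x q v : ℝ) : Prop :=
  ∀ p : ℝ, p * q - H j x p ≤ v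

/-- the set of costs `∫ L(γ, γ̇)` of piecewise differentiable paths from `y` to `x`
(encoded via integrable majorants of the Legendre transform along the path, so that
the possibly `+∞`-valued Lagrangian is handled inside `ℝ`) -/
def ScostSet (H : J → ℝ → ℝ → ℝ) (y x : EuclideanSpace ℝ (Fin N)) : Set ℝ :=
  {c : ℝ | ∃ γ : G.PWPath y x, ∃ ℓ : ℕ → ℝ → ℝ,
    (∀ m ≤ γ.n, IntervalIntegrable (ℓ m) MeasureTheory.volume (γ.t m) (γ.t (m + 1))) ∧
    (∀ m ≤ γ.n, ∀ s ∈ Set.Icc (γ.t m) (γ.t (m + 1)),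
      LagrangianLE H (γ.e m) (γ.g m s)
        (derivWithin (γ.g m) (Set.Icc (γ.t m) (γ.t (m + 1))) s) (ℓ m s)) ∧
    c = ∑ m ∈ Finset.range (γ.n + 1), ∫ s in (γ.t m)..(γ.t (m + 1)), ℓ m s}

/-- the distance `S(y,x)` associated to the Hamiltonian `H` -/
noncomputable def Sdist (H : J → ℝ → ℝ → ℝ) (y x : EuclideanSpace ℝ (Fin N)) : ℝ :=
  sInf (G.ScostSet H y x)

end TopNetwork

open scoped Topology

/-- Penalisation: if `w < M` on the zero set of the penalty `D` inside a compact set, then a large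
multiple of `D` forces `w - n D < M` on the whole set. -/
theorem eventually_sub_penalty_lt {α : Type*} [TopologicalSpace α] {F : Set α}
    (hF : IsCompact F) {w D : α → ℝ} (hw : UpperSemicontinuousOn w F) (hD : ContinuousOn D F)
    (hD0 : ∀ z, 0 ≤ D z) {M : ℝ} (hM : ∀ z ∈ F, D z = 0 → w z < M) :
    ∀ᶠ n : ℕ in atTop, ∀ z ∈ F, w z - n * D z < M := by
  refine hF.induction_on (p := fun S => ∀ᶠ n : ℕ in atTop, ∀ z ∈ S, w z - n * D z < M)
    (by simp) (fun s t hst ht => ht.mono fun n hn z hz => hn z (hst hz))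
    (fun s t hs ht => ?_) (fun z hz => ?_)
  · filter_upwards [hs, ht] with n h1 h2 z hz
    exact hz.elim (h1 z) (h2 z)
  · obtain ⟨m, hm⟩ : ∃ m : ℕ, w z - m * D z < M := by
      rcases (hD0 z).eq_or_lt with h0 | hpos
      · exact ⟨0, by simpa using hM z hz h0.symm⟩
      · obtain ⟨m, hm⟩ := exists_nat_gt ((w z - M) / D z)
        rw [div_lt_iff₀ hpos] at hm
        exact ⟨m, by linarith⟩
    have husc : UpperSemicontinuousOn (fun z => w z + -(m * D z)) F :=
      hw.add ((continuousOn_const.mul hD).neg.upperSemicontinuousOn)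
    have hev := husc z hz M (by linarith)
    refine ⟨_, hev, ?_⟩
    filter_upwards [eventually_ge_atTop m] with n hn y hy
    have hy' : w y + -(m * D y) < M := hy
    have : (m : ℝ) * D y ≤ n * D y := by
      have := hD0 y
      gcongr
    linarith

/-- A convex coercive Hamiltonian, continuous up to `s = 0`: momenta in the sublevel `≤ -η` near
`s = 0` satisfy a strict inequality at all nearby points. -/
theorem exists_uniform_momentum_bound {h : ℝ → ℝ → ℝ} {r : ℝ} (hr : 0 < r)
    (hc : ContinuousOn (fun q : ℝ × ℝ => h q.1 q.2) (Icc 0 r ×ˢ univ))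
    (hconv : ∀ s ∈ Icc 0 r, ConvexOn ℝ univ (h s))
    (hcoer : ∀ C : ℝ, ∃ R > 0, C < h 0 R ∧ C < h 0 (-R)) :
    ∃ R > 0, ∃ δ > 0, δ ≤ r ∧ ∀ s ∈ Icc 0 δ, ∀ p, h s p ≤ 0 → |p| ≤ R := by
  obtain ⟨R, hR, hR1, hR2⟩ := hcoer (|h 0 0| + 1)
  have h00 : (0 : ℝ) ∈ Icc 0 r := ⟨le_rfl, hr.le⟩
  have key : ∀ p, Tendsto (fun s => h s p) (𝓝[Icc 0 r] 0) (nhds (h 0 p)) := by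
    intro p
    have : ContinuousOn (fun s : ℝ => h s p) (Icc 0 r) :=
      hc.comp (f := fun s : ℝ => (s, p)) (by fun_prop) (fun s hs => ⟨hs, mem_univ _⟩)
    exact this 0 h00
  have e1 := (key R).eventually_const_lt hR1
  have e2 := (key (-R)).eventually_const_lt hR2
  have e3 := (key 0).eventually_lt_const (show h 0 0 < |h 0 0| + 1 by linarith [le_abs_self (h 0 0)])
  have e := e1.and (e2.and e3)
  rw [eventually_nhdsWithin_iff, Metric.eventually_nhds_iff] at e
  obtain ⟨δ, hδ, hδ'⟩ := e
  refine ⟨R, hR, min (δ / 2) r, lt_min (by linarith) hr, min_le_right _ _, ?_⟩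
  intro s hs p hp
  have hsr : s ∈ Icc 0 r := ⟨hs.1, hs.2.trans (min_le_right _ _)⟩
  have hsδ : dist s 0 < δ := by
    rw [Real.dist_eq, sub_zero, abs_of_nonneg hs.1]
    linarith [hs.2.trans (min_le_left _ _)]
  obtain ⟨a1, a2, a3⟩ := hδ' hsδ hsr
  have hpos : 0 ≤ |h 0 0| := abs_nonneg _
  by_contra hlt
  push Not at hlt
  have cv := hconv s hsr
  have gen : ∀ q, |h 0 0| + 1 < h s q → ∀ c : ℝ, 1 < c → p = c * q → False := by
    intro q hq c hc1 hpq
    have hci : 0 ≤ c⁻¹ := by positivity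
    have hci1 : c⁻¹ ≤ 1 := inv_le_one_of_one_le₀ hc1.le
    have := cv.2 (mem_univ p) (mem_univ 0) hci (sub_nonneg.2 hci1) (by ring)
    have hqe : c⁻¹ • p + (1 - c⁻¹) • (0 : ℝ) = q := by
      rw [hpq]
      simp only [smul_eq_mul]
      field_simp
      ring
    rw [hqe] at this
    simp only [smul_eq_mul] at this
    nlinarith
  rcases le_or_gt 0 p with h0 | h0
  · rw [abs_of_nonneg h0] at hlt
    exact gen R a1 (p / R) ((one_lt_div hR).2 hlt) (by field_simp)
  · rw [abs_of_neg h0] at hlt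
    exact gen (-R) a2 (-p / R) ((one_lt_div hR).2 hlt) (by field_simp)

theorem exists_uniform_modulus {h : ℝ → ℝ → ℝ} {r η R : ℝ} (hη : 0 < η)
    (hc : ContinuousOn (fun q : ℝ × ℝ => h q.1 q.2) (Icc 0 r ×ˢ univ)) :
    ∃ δ > 0, ∀ s ∈ Icc 0 r, ∀ t ∈ Icc 0 r, |s - t| < δ → ∀ p q, |p| ≤ R → |q| ≤ R →
      |p - q| < δ → |h s p - h t q| < η := by
  have hK : IsCompact (Icc 0 r ×ˢ Icc (-R) R) := isCompact_Icc.prod isCompact_Icc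
  have := hK.uniformContinuousOn_of_continuous (hc.mono (prod_mono_right (subset_univ _)))
  rw [Metric.uniformContinuousOn_iff] at this
  obtain ⟨δ, hδ, H⟩ := this η hη
  refine ⟨δ, hδ, fun s hs t ht hst p q hp hq hpq => ?_⟩
  exact H (s, p) ⟨hs, abs_le.1 hp⟩ (t, q) ⟨ht, abs_le.1 hq⟩ (by
    rw [Prod.dist_eq]
    exact max_lt (by rwa [Real.dist_eq]) (by rwa [Real.dist_eq]))

/-- Strict inequality at one point of a star near its centre transfers to nearby momenta and
points on all rays. -/
theorem exists_star_strict_radius {A : Type*} [Finite A] {h : A → ℝ → ℝ → ℝ} {r η : ℝ}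
    (hr : 0 < r) (hη : 0 < η)
    (hc : ∀ a, ContinuousOn (fun q : ℝ × ℝ => h a q.1 q.2) (Icc 0 r ×ˢ univ))
    (hconv : ∀ a, ∀ s ∈ Icc 0 r, ConvexOn ℝ univ (h a s))
    (hcoer : ∀ a, ∀ C : ℝ, ∃ R > 0, C < h a 0 R ∧ C < h a 0 (-R))
    (hcomp : ∀ a b, a ≠ b → ∀ p, h a 0 p = h b 0 (-p)) :
    ∃ δ > 0, δ ≤ r ∧ ∀ a b, ∀ s ∈ Ico 0 δ, ∀ t ∈ Ico 0 δ, ∀ P,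
      h a s (2 * s + P) ≤ -η → (a = b → h b t P < 0) ∧ (a ≠ b → h b t (-P) < 0) := by
  choose R hR δ₁ hδ₁ hδ₁r hb using
    fun a => exists_uniform_momentum_bound hr (hc a) (hconv a) (hcoer a)
  obtain ⟨R₀, hR₀⟩ := (finite_range R).bddAbove
  obtain ⟨d₁, hd₁, hd₁'⟩ : ∃ d > 0, ∀ a, d ≤ δ₁ a := by
    rcases isEmpty_or_nonempty A with hA | hA
    · exact ⟨1, one_pos, fun a => hA.elim a⟩
    · obtain ⟨a, ha⟩ := Finite.exists_min δ₁
      exact ⟨δ₁ a, hδ₁ a, ha⟩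
  choose δ₂ hδ₂ hu using
    fun a => exists_uniform_modulus (R := R₀ + 2) (show 0 < η / 4 by linarith) (hc a)
  obtain ⟨d₂, hd₂, hd₂'⟩ : ∃ d > 0, ∀ a, d ≤ δ₂ a := by
    rcases isEmpty_or_nonempty A with hA | hA
    · exact ⟨1, one_pos, fun a => hA.elim a⟩
    · obtain ⟨a, ha⟩ := Finite.exists_min δ₂
      exact ⟨δ₂ a, hδ₂ a, ha⟩
  refine ⟨min (min d₁ r) (min 1 (d₂ / 2)), by positivity,
    (min_le_left _ _).trans (min_le_right _ _), ?_⟩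
  intro a b s hs t ht P hP
  simp only [mem_Ico, lt_min_iff] at hs ht
  obtain ⟨hs0, ⟨hs1, hsr⟩, hs2, hs3⟩ := hs
  obtain ⟨ht0, ⟨ht1, htr⟩, ht2, ht3⟩ := ht
  have hpb : |2 * s + P| ≤ R₀ :=
    (hb a s ⟨hs0, hs1.le.trans (hd₁' a)⟩ _ (by linarith)).trans (hR₀ (mem_range_self a))
  have hPb : |P| ≤ R₀ + 2 := by
    rw [abs_le] at hpb ⊢
    constructor <;> linarith
  have h0r : (0 : ℝ) ∈ Icc 0 r := ⟨le_rfl, hr.le⟩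
  have k1 := hu a s ⟨hs0, hsr.le⟩ 0 h0r
    (by rw [sub_zero, abs_of_nonneg hs0]; linarith [hd₂' a]) (2 * s + P) P (by linarith) hPb
    (by rw [add_sub_cancel_right, abs_of_nonneg (by linarith)]; linarith [hd₂' a])
  have k2 : ∀ q, |q| ≤ R₀ + 2 → |h b t q - h b 0 q| < η / 4 := fun q hq =>
    hu b t ⟨ht0, htr.le⟩ 0 h0r (by rw [sub_zero, abs_of_nonneg ht0]; linarith [hd₂' b]) q q hq hq
      (by simpa using hδ₂ b)
  rw [abs_lt] at k1
  constructor
  · rintro rfl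
    have k3 := abs_lt.1 (k2 P hPb)
    linarith [k1.1, k3.2]
  · intro hab
    have k3 := abs_lt.1 (k2 (-P) (by rwa [abs_neg]))
    linarith [k1.1, k3.2, hcomp a b hab P]

open Classical in
/-- Comparison at the centre of a star: `u - v` cannot be maximal at the centre of a star on which
`u` is a strict viscosity subsolution and `v` a viscosity supersolution. -/
theorem star_comparison {A : Type*} [Finite A] [Nonempty A] {h : A → ℝ → ℝ → ℝ}
    {u v : A → ℝ → ℝ} {u₀ v₀ r η : ℝ} (hr : 0 < r) (hη : 0 < η)
    (hc : ∀ a, ContinuousOn (fun q : ℝ × ℝ => h a q.1 q.2) (Icc 0 r ×ˢ univ))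
    (hconv : ∀ a, ∀ s ∈ Icc 0 r, ConvexOn ℝ univ (h a s))
    (hcoer : ∀ a, ∀ C : ℝ, ∃ R > 0, C < h a 0 R ∧ C < h a 0 (-R))
    (hcomp : ∀ a b, a ≠ b → ∀ p, h a 0 p = h b 0 (-p))
    (husc : ∀ a, UpperSemicontinuousOn (u a) (Icc 0 r))
    (hlsc : ∀ a, LowerSemicontinuousOn (v a) (Icc 0 r))
    (hu0 : ∀ a, u a 0 = u₀) (hv0 : ∀ a, v a 0 = v₀)
    (hmax : ∀ a, ∀ s ∈ Icc 0 r, u a s - v a s ≤ u₀ - v₀)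
    (hsub : ∀ a, ∀ s ∈ Ioo 0 r, ∀ g : ℝ → ℝ, ∀ p, Continuous g → HasDerivAt g p s →
      (∀ᶠ s' in 𝓝 s, u a s' - g s' ≤ u a s - g s) → h a s p ≤ -η)
    (hsub0 : ∀ a, ∀ g : ℝ → ℝ, ∀ p, Continuous g → HasDerivAt g p 0 →
      (∀ᶠ s in 𝓝[≥] 0, u a s - g (-s) ≤ u₀ - g 0) →
      (∀ b, b ≠ a → ∀ᶠ s in 𝓝[≥] 0, u b s - g s ≤ u₀ - g 0) → h a 0 (-p) ≤ -η)
    (hsup : ∀ a, ∀ s ∈ Ioo 0 r, ∀ g : ℝ → ℝ, ∀ p, Continuous g → HasDerivAt g p s →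
      (∀ᶠ s' in 𝓝 s, v a s - g s ≤ v a s' - g s') → 0 ≤ h a s p)
    (hsup0 : ∀ a, ∀ g : ℝ → ℝ, ∀ p, Continuous g → HasDerivAt g p 0 →
      (∀ᶠ s in 𝓝[≥] 0, v₀ - g 0 ≤ v a s - g (-s)) →
      (∀ b, b ≠ a → ∀ᶠ s in 𝓝[≥] 0, v₀ - g 0 ≤ v b s - g s) → 0 ≤ h a 0 (-p)) :
    False := by
  obtain ⟨δ, hδ, hδr, hstrict⟩ := exists_star_strict_radius hr hη hc hconv hcoer hcomp
  let k : A → A → ℝ := fun a b => if a = b then -1 else 1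
  have hkaa : ∀ a, k a a = -1 := fun a => if_pos rfl
  have hkab : ∀ a b, a ≠ b → k a b = 1 := fun a b hab => if_neg hab
  let w : A → A → ℝ × ℝ → ℝ := fun a b z => (u a z.1 + -v b z.2) + -(z.1 ^ 2)
  let D : A → A → ℝ × ℝ → ℝ := fun a b z => (z.1 + k a b * z.2) ^ 2
  have hw : ∀ a b, UpperSemicontinuousOn (w a b) (Icc 0 r ×ˢ Icc 0 r) := by
    intro a b
    have h1 : UpperSemicontinuousOn (fun z : ℝ × ℝ => u a z.1) (Icc 0 r ×ˢ Icc 0 r) :=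
      (husc a).comp continuous_fst.continuousOn (fun z hz => hz.1)
    have h2 : UpperSemicontinuousOn (fun z : ℝ × ℝ => -v b z.2) (Icc 0 r ×ˢ Icc 0 r) :=
      (hlsc b).neg.comp continuous_snd.continuousOn (fun z hz => hz.2)
    exact (h1.add h2).add (ContinuousOn.upperSemicontinuousOn (by fun_prop))
  have hD : ∀ a b, Continuous (D a b) := fun a b => by fun_prop
  have hK : IsCompact (Icc (0 : ℝ) r ×ˢ Icc (0 : ℝ) r) := isCompact_Icc.prod isCompact_Icc
  have hF : IsCompact ((Icc (0 : ℝ) r ×ˢ Icc (0 : ℝ) r) ∩ {z | δ ≤ z.1 ∨ δ ≤ z.2}) :=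
    hK.inter_right ((isClosed_le continuous_const continuous_fst).union
      (isClosed_le continuous_const continuous_snd))
  have hfar : ∀ᶠ n : ℕ in atTop, ∀ a b, ∀ z ∈ (Icc (0 : ℝ) r ×ˢ Icc (0 : ℝ) r) ∩
      {z | δ ≤ z.1 ∨ δ ≤ z.2}, w a b z - n * D a b z < u₀ - v₀ := by
    rw [eventually_all]
    intro a
    rw [eventually_all]
    intro b
    refine eventually_sub_penalty_lt hF ((hw a b).mono inter_subset_left) (hD a b).continuousOn
      (fun z => sq_nonneg _) ?_
    rintro ⟨s, t⟩ ⟨⟨hs, ht⟩, hst⟩ h0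
    have h0' : s + k a b * t = 0 := by simpa [D] using h0
    simp only [mem_ofPred_eq] at hst hs ht
    by_cases hab : a = b
    · subst hab
      rw [hkaa] at h0'
      have hts : t = s := by linarith
      subst hts
      have htp : δ ≤ t := hst.elim id id
      have := hmax a t hs
      simp only [w]
      nlinarith
    · rw [hkab a b hab] at h0'
      exfalso
      rcases hst with h | h <;> linarith [hs.1, ht.1]
  obtain ⟨n, hn⟩ := hfar.exists
  have hex : ∀ q : A × A, ∃ z ∈ Icc (0 : ℝ) r ×ˢ Icc (0 : ℝ) r,
      ∀ y ∈ Icc (0 : ℝ) r ×ˢ Icc (0 : ℝ) r,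
        w q.1 q.2 y - n * D q.1 q.2 y ≤ w q.1 q.2 z - n * D q.1 q.2 z := by
    intro q
    have hne : (Icc (0 : ℝ) r ×ˢ Icc (0 : ℝ) r).Nonempty := ⟨(0, 0), by simp [hr.le]⟩
    have hus : UpperSemicontinuousOn (fun z => w q.1 q.2 z + -(n * D q.1 q.2 z))
        (Icc (0 : ℝ) r ×ˢ Icc (0 : ℝ) r) :=
      (hw _ _).add (ContinuousOn.upperSemicontinuousOn
        (((hD q.1 q.2).continuousOn.const_mul _).neg))
    obtain ⟨z, hz, hzm⟩ := hus.exists_isMaxOn hne hK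
    refine ⟨z, hz, fun y hy => ?_⟩
    simpa [sub_eq_add_neg] using hzm hy
  choose z hz hzm using hex
  obtain ⟨q, hq⟩ := Finite.exists_max (fun q : A × A => w q.1 q.2 (z q) - n * D q.1 q.2 (z q))
  -- a global maximum point for which both points lie on one ray if one of them is the centre
  obtain ⟨a, b, s, t, hs, ht, hs0, ht0, hglob⟩ : ∃ a b s t, s ∈ Icc (0 : ℝ) r ∧
      t ∈ Icc (0 : ℝ) r ∧ (s = 0 → a = b) ∧ (t = 0 → a = b) ∧
      ∀ c d, ∀ s' ∈ Icc (0 : ℝ) r, ∀ t' ∈ Icc (0 : ℝ) r,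
        w c d (s', t') - n * D c d (s', t') ≤ w a b (s, t) - n * D a b (s, t) := by
    have hglob : ∀ c d, ∀ s' ∈ Icc (0 : ℝ) r, ∀ t' ∈ Icc (0 : ℝ) r,
        w c d (s', t') - n * D c d (s', t') ≤ w q.1 q.2 (z q) - n * D q.1 q.2 (z q) :=
      fun c d s' hs' t' ht' => (hzm (c, d) (s', t') ⟨hs', ht'⟩).trans (hq (c, d))
    by_cases h1 : (z q).1 = 0
    · refine ⟨q.2, q.2, (z q).1, (z q).2, (hz q).1, (hz q).2, fun _ => rfl, fun _ => rfl, ?_⟩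
      have : w q.2 q.2 ((z q).1, (z q).2) - n * D q.2 q.2 ((z q).1, (z q).2)
          = w q.1 q.2 (z q) - n * D q.1 q.2 (z q) := by
        simp only [w, D, h1, hu0, k]
        split_ifs <;> ring
      rwa [this]
    by_cases h2 : (z q).2 = 0
    · refine ⟨q.1, q.1, (z q).1, (z q).2, (hz q).1, (hz q).2, fun _ => rfl, fun _ => rfl, ?_⟩
      have : w q.1 q.1 ((z q).1, (z q).2) - n * D q.1 q.1 ((z q).1, (z q).2)
          = w q.1 q.2 (z q) - n * D q.1 q.2 (z q) := by
        simp only [w, D, h2, hv0, k]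
        split_ifs <;> ring
      rwa [this]
    exact ⟨q.1, q.2, (z q).1, (z q).2, (hz q).1, (hz q).2, fun h => absurd h h1,
      fun h => absurd h h2, hglob⟩
  have h0r : (0 : ℝ) ∈ Icc 0 r := ⟨le_rfl, hr.le⟩
  have hnear : s < δ ∧ t < δ := by
    by_contra hcon
    have hmem : (s, t) ∈ (Icc (0 : ℝ) r ×ˢ Icc (0 : ℝ) r) ∩ {z | δ ≤ z.1 ∨ δ ≤ z.2} := by
      refine ⟨⟨hs, ht⟩, ?_⟩
      simp only [mem_ofPred_eq]
      by_contra! h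
      exact hcon h
    have h1 := hn a b (s, t) hmem
    have h2 := hglob a a 0 h0r 0 h0r
    have h3 : w a a (0, 0) - n * D a a (0, 0) = u₀ - v₀ := by
      simp only [w, D, hu0, hv0]
      ring
    linarith
  have hIcc : ∀ᶠ s' in 𝓝[≥] (0 : ℝ), s' ∈ Icc 0 r := Icc_mem_nhdsGE hr
  have hIoo : ∀ s ∈ Ioo 0 r, ∀ᶠ s' in 𝓝 s, s' ∈ Icc 0 r := fun s hs =>
    Icc_mem_nhds hs.1 hs.2
  set P : ℝ := 2 * n * (s + k a b * t) with hP
  have hsubineq : h a s (2 * s + P) ≤ -η := by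
    rcases hs.1.eq_or_lt with h0 | hpos
    · subst h0
      obtain rfl := hs0 rfl
      have := hsub0 a (fun x => x ^ 2 + n * (x + t) ^ 2) (2 * n * t) (by fun_prop)
        (by
          have h1 := ((hasDerivAt_id (0 : ℝ)).pow 2).add
            ((((hasDerivAt_id (0 : ℝ)).add_const t).pow 2).const_mul (n : ℝ))
          refine h1.congr_deriv ?_
          simp
          ring)
        (by
          filter_upwards [hIcc] with x hx
          have := hglob a a x hx t ht
          simp only [w, D, hkaa, hu0] at this
          nlinarith)
        (by
          intro c hca
          filter_upwards [hIcc] with x hx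
          have := hglob c a x hx t ht
          simp only [w, D, hkaa, hkab c a hca, hu0] at this
          nlinarith)
      convert this using 2
      rw [hP, hkaa]
      ring
    · have hsI : s ∈ Ioo 0 r := ⟨hpos, hnear.1.trans_le hδr⟩
      refine hsub a s hsI (fun x => x ^ 2 + n * (x + k a b * t) ^ 2) _ (by fun_prop) ?_ ?_
      · have h1 := ((hasDerivAt_id s).pow 2).add
            ((((hasDerivAt_id s).add_const (k a b * t)).pow 2).const_mul (n : ℝ))
        refine h1.congr_deriv ?_
        simp [hP]
        ring
      · filter_upwards [hIoo s hsI] with x hx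
        have := hglob a b x hx t ht
        simp only [w, D] at this
        linarith
  have hsupineq : 0 ≤ h b t (-(k a b) * P) := by
    rcases ht.1.eq_or_lt with h0 | hpos
    · subst h0
      obtain rfl := ht0 rfl
      have := hsup0 a (fun x => -(n * (x + s) ^ 2)) (-(2 * n * s)) (by fun_prop)
        (by
          have h1 := ((((hasDerivAt_id (0 : ℝ)).add_const s).pow 2).const_mul (n : ℝ)).neg
          refine h1.congr_deriv ?_
          simp
          ring)
        (by
          filter_upwards [hIcc] with x hx
          have := hglob a a s hs x hx
          simp only [w, D, hkaa, hv0] at this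
          nlinarith)
        (by
          intro c hca
          filter_upwards [hIcc] with x hx
          have := hglob a c s hs x hx
          simp only [w, D, hkaa, hkab a c (Ne.symm hca), hv0] at this
          nlinarith)
      convert this using 2
      rw [hP, hkaa]
      ring
    · have htI : t ∈ Ioo 0 r := ⟨hpos, hnear.2.trans_le hδr⟩
      refine hsup b t htI (fun x => -(n * (s + k a b * x) ^ 2)) _ (by fun_prop) ?_ ?_
      · have h1 := (((((hasDerivAt_id t).const_mul (k a b)).const_add s).pow 2).const_mul
          (n : ℝ)).neg
        refine h1.congr_deriv ?_
        simp [hP]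
        ring
      · filter_upwards [hIoo t htI] with x hx
        have := hglob a b s hs x hx
        simp only [w, D] at this
        linarith
  have hfin := hstrict a b s ⟨hs.1, hnear.1⟩ t ⟨ht.1, hnear.2⟩ P hsubineq
  by_cases hab : a = b
  · have h1 := hfin.1 hab
    subst hab
    rw [hkaa, neg_neg, one_mul] at hsupineq
    linarith
  · have h1 := hfin.2 hab
    rw [hkab a b hab, neg_one_mul] at hsupineq
    linarith

namespace TopNetwork

variable {N : ℕ} {I J : Type} [Fintype I] [Fintype J] (G : TopNetwork N I J)

theorem continuousOn_π (j : J) : ContinuousOn (G.π j) (Icc 0 (G.l j)) :=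
  fun t ht => (G.π_diff j t ht).continuousWithinAt

theorem isCompact_edgeC (j : J) : IsCompact (G.edgeC j) :=
  isCompact_Icc.image_of_continuousOn (G.continuousOn_π j)

theorem isCompact_Gbar : IsCompact G.Gbar := isCompact_iUnion G.isCompact_edgeC

theorem isClosed_bdry : IsClosed G.bdry := by
  refine ((finite_range G.V).subset ?_).isClosed
  rintro x ⟨i, -, rfl⟩
  exact mem_range_self i

theorem π_mem_Gbar {j : J} {t : ℝ} (ht : t ∈ Icc 0 (G.l j)) : G.π j t ∈ G.Gbar :=
  mem_iUnion.2 ⟨j, mem_image_of_mem _ ht⟩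

theorem tendsto_π {j : J} {t : ℝ} (ht : t ∈ Icc 0 (G.l j)) :
    Tendsto (G.π j) (𝓝[Icc 0 (G.l j)] t) (𝓝[G.Gbar] (G.π j t)) :=
  tendsto_nhdsWithin_iff.2 ⟨G.continuousOn_π j t ht,
    eventually_mem_nhdsWithin.mono fun _ hs => G.π_mem_Gbar hs⟩

theorem nhdsWithin_edgeC {j : J} {t : ℝ} (ht : t ∈ Icc 0 (G.l j)) :
    𝓝[G.edgeC j] (G.π j t) = map (G.π j) (𝓝[Icc 0 (G.l j)] t) := by
  have hcont : Continuous ((Icc 0 (G.l j)).domRestrict (G.π j)) := (G.continuousOn_π j).domRestrict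
  have hemb := hcont.isClosedEmbedding (G.π_inj j).injective
  have h := hemb.isEmbedding.map_nhds_eq ⟨t, ht⟩
  rw [range_domRestrict] at h
  rw [nhdsWithin_eq_map_subtype_coe ht, Filter.map_map]
  exact h.symm

/-- A property holds near `x` in the network if it holds near `x` along every edge. -/
theorem eventually_nhdsWithin_Gbar {x : EuclideanSpace ℝ (Fin N)}
    {P : EuclideanSpace ℝ (Fin N) → Prop}
    (h : ∀ j, ∀ t ∈ Icc 0 (G.l j), G.π j t = x → ∀ᶠ s in 𝓝[Icc 0 (G.l j)] t, P (G.π j s)) :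
    ∀ᶠ y in 𝓝[G.Gbar] x, P y := by
  rw [Gbar, nhdsWithin_iUnion, eventually_iSup]
  intro j
  by_cases hx : x ∈ G.edgeC j
  · obtain ⟨t, ht, rfl⟩ := hx
    rw [G.nhdsWithin_edgeC ht]
    exact h j t ht rfl
  · rw [← (G.isCompact_edgeC j).isClosed.closure_eq,
      mem_closure_iff_nhdsWithin_neBot, not_neBot] at hx
    rw [hx]
    exact eventually_bot

theorem continuousOn_Gbar {φ : EuclideanSpace ℝ (Fin N) → ℝ}
    (h : ∀ j, ContinuousOn (fun t => φ (G.π j t)) (Icc 0 (G.l j))) :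
    ContinuousOn φ G.Gbar := by
  intro x _ U hU
  refine G.eventually_nhdsWithin_Gbar fun j t ht hx => ?_
  subst hx
  exact h j t ht hU

theorem π_zero_ne (j : J) : G.π j 0 ≠ G.π j (G.l j) := fun h =>
  (G.l_pos j).ne (G.π_inj j ⟨le_rfl, (G.l_pos j).le⟩ ⟨(G.l_pos j).le, le_rfl⟩ h)

theorem π_Ioo_notMem_range {j : J} {t : ℝ} (ht : t ∈ Ioo 0 (G.l j)) :
    G.π j t ∉ range G.V := by
  intro hV
  have hl := (G.l_pos j).le
  have h0 : (0 : ℝ) ∈ Icc 0 (G.l j) := ⟨le_rfl, hl⟩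
  have h1 : G.l j ∈ Icc 0 (G.l j) := ⟨hl, le_rfl⟩
  have ht' : t ∈ Icc 0 (G.l j) := Ioo_subset_Icc_self ht
  obtain ⟨i₀, hi₀⟩ := G.start_mem j
  obtain ⟨i₁, hi₁⟩ := G.end_mem j
  have hsub : ({G.π j 0, G.π j (G.l j), G.π j t} : Set _) ⊆
      G.π j '' Icc 0 (G.l j) ∩ range G.V := by
    rintro y (rfl | rfl | rfl)
    · exact ⟨mem_image_of_mem _ h0, i₀, hi₀.symm⟩
    · exact ⟨mem_image_of_mem _ h1, i₁, hi₁.symm⟩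
    · exact ⟨mem_image_of_mem _ ht', hV⟩
  have hle := ncard_le_ncard hsub ((finite_range G.V).subset inter_subset_right)
  rw [G.edge_two_vertices j] at hle
  have h3 : ({G.π j 0, G.π j (G.l j), G.π j t} : Set _).ncard = 3 :=
    ncard_eq_three.2 ⟨_, _, _, G.π_zero_ne j,
      fun h => ht.1.ne (G.π_inj j h0 ht' h), fun h => ht.2.ne' (G.π_inj j h1 ht' h), rfl⟩
  omega

theorem edge_unique {j k : J} {t s : ℝ} (ht : t ∈ Ioo 0 (G.l j)) (hs : s ∈ Icc 0 (G.l k))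
    (h : G.π k s = G.π j t) : k = j ∧ s = t := by
  have hkj : k = j := by
    by_contra hne
    exact G.π_Ioo_notMem_range ht (G.edges_cap_sub j k (Ne.symm hne)
      ⟨mem_image_of_mem _ (Ioo_subset_Icc_self ht), s, hs, h⟩)
  subst hkj
  exact ⟨rfl, G.π_inj k hs (Ioo_subset_Icc_self ht) h⟩

theorem inc_cases {i : I} {j : J} (h : j ∈ G.Inc i) :
    (G.vt i j = 0 ∧ G.a i j = 1 ∧ G.π j 0 = G.V i) ∨
      (G.vt i j = G.l j ∧ G.a i j = -1 ∧ G.π j (G.l j) = G.V i) := by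
  by_cases h0 : G.π j 0 = G.V i
  · exact Or.inl ⟨if_pos h0, if_pos h0, h0⟩
  · have h1 : G.π j (G.l j) = G.V i := h.resolve_left h0
    refine Or.inr ⟨if_neg h0, ?_, h1⟩
    rw [a, if_neg h0, if_pos h1]

theorem inc_of_π_eq {i : I} {j : J} {t : ℝ} (ht : t ∈ Icc 0 (G.l j)) (h : G.π j t = G.V i) :
    j ∈ G.Inc i ∧ t = G.vt i j := by
  rcases ht.1.eq_or_lt with h0 | h0
  · subst h0
    exact ⟨Or.inl h, (if_pos h).symm⟩
  rcases ht.2.eq_or_lt with h1 | h1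
  · subst h1
    exact ⟨Or.inr h, (if_neg fun h' => G.π_zero_ne j (h'.trans h.symm)).symm⟩
  · exact absurd ⟨i, h.symm⟩ (G.π_Ioo_notMem_range ⟨h0, h1⟩)

theorem exists_inc_ne {i : I} (hi : i ∈ G.IT) {j : J} (hj : j ∈ G.Inc i) :
    ∃ k ∈ G.Inc i, k ≠ j := by
  by_contra! h
  refine hi (G.deg_one_bdry i (ncard_eq_one.2 ⟨j, ?_⟩))
  exact Subset.antisymm (fun k hk => h k hk) (singleton_subset_iff.2 hj)

open Classical in
/-- Functions on the edges that vanish at the endpoints glue to a continuous function. -/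
theorem exists_glue {g : J → ℝ → ℝ} (hg : ∀ j, Continuous (g j)) (h0 : ∀ j, g j 0 = 0)
    (hl : ∀ j, g j (G.l j) = 0) :
    ∃ φ : EuclideanSpace ℝ (Fin N) → ℝ, ContinuousOn φ G.Gbar ∧
      ∀ j, ∀ t ∈ Icc 0 (G.l j), φ (G.π j t) = g j t := by
  let φ : EuclideanSpace ℝ (Fin N) → ℝ := fun x =>
    if h : ∃ q : J × ℝ, q.2 ∈ Ioo 0 (G.l q.1) ∧ G.π q.1 q.2 = x then
      g h.choose.1 h.choose.2 else 0
  have hφ : ∀ j, ∀ t ∈ Icc 0 (G.l j), φ (G.π j t) = g j t := by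
    intro j t ht
    by_cases h : ∃ q : J × ℝ, q.2 ∈ Ioo 0 (G.l q.1) ∧ G.π q.1 q.2 = G.π j t
    · have hc := h.choose_spec
      obtain ⟨h1, h2⟩ := G.edge_unique hc.1 ht hc.2.symm
      simp only [φ, dif_pos h]
      rw [← h1, ← h2]
    · simp only [φ, dif_neg h]
      rcases ht.1.eq_or_lt with h0' | h0'
      · rw [← h0', h0]
      rcases ht.2.eq_or_lt with h1 | h1
      · rw [h1, hl]
      · exact absurd ⟨(j, t), ⟨h0', h1⟩, rfl⟩ h
  exact ⟨φ, G.continuousOn_Gbar fun j => (hg j).continuousOn.congr (hφ j), hφ⟩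

theorem exists_inc_of_vertex (i : I) : ∃ j, j ∈ G.Inc i := by
  obtain ⟨_, f, ⟨t, ht, h⟩, -⟩ := G.connected i i
  exact ⟨f 0, (G.inc_of_π_eq ht h).1⟩

theorem Gbar_cases {x : EuclideanSpace ℝ (Fin N)} (hx : x ∈ G.Gbar) :
    (∃ i, x = G.V i) ∨ ∃ j, ∃ t ∈ Ioo 0 (G.l j), x = G.π j t := by
  obtain ⟨j, t, ht, rfl⟩ := mem_iUnion.1 hx
  rcases ht.1.eq_or_lt with h0 | h0
  · left
    rw [← h0]
    exact G.start_mem j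
  rcases ht.2.eq_or_lt with h1 | h1
  · left
    rw [h1]
    exact G.end_mem j
  · exact Or.inr ⟨j, t, ⟨h0, h1⟩, rfl⟩

/-- If `u - v` is maximal at `x₀` over the network, then `x₀` cannot be the centre of a star of
rays `s ↦ π (e a) (t₀ a + σ a * s)` on which `u` is a strict subsolution and `v` a supersolution. -/
theorem star_comparison {A : Type*} [Finite A] [Nonempty A] {H : J → ℝ → ℝ → ℝ}
    (hH : G.IsEikonalHamiltonian H) {f u v : EuclideanSpace ℝ (Fin N) → ℝ}
    {Ω : Set (EuclideanSpace ℝ (Fin N))} (hu : G.IsSubSolOn H f u Ω)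
    (hv : G.IsSuperSolOn H (fun _ => (0 : ℝ)) v Ω)
    {x₀ : EuclideanSpace ℝ (Fin N)} (hmax : ∀ x ∈ G.Gbar, u x - v x ≤ u x₀ - v x₀)
    {e : A → J} {t₀ σ : A → ℝ} {r η : ℝ} (hr : 0 < r) (hη : 0 < η)
    (hσ : ∀ a, σ a = 1 ∨ σ a = -1) (ht₀ : ∀ a, t₀ a ∈ Icc 0 (G.l (e a)))
    (hx₀ : ∀ a, G.π (e a) (t₀ a) = x₀)
    (hIoo : ∀ a, ∀ s ∈ Ioc 0 r, t₀ a + σ a * s ∈ Ioo 0 (G.l (e a)))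
    (hρ : ∀ a, ∃ ρ : EuclideanSpace ℝ (Fin N) → ℝ, ContinuousOn ρ G.Gbar ∧ ∀ s ∈ Icc 0 r,
      ρ (G.π (e a) (t₀ a + σ a * s)) = -s ∧
      ∀ b, b ≠ a → ρ (G.π (e b) (t₀ b + σ b * s)) = s)
    (hnb : ∀ P : EuclideanSpace ℝ (Fin N) → Prop,
      (∀ a, ∀ᶠ s in 𝓝[≥] (0 : ℝ), P (G.π (e a) (t₀ a + σ a * s))) → ∀ᶠ y in 𝓝[G.Gbar] x₀, P y)
    (hcomp : ∀ a b, a ≠ b → ∀ p, H (e a) (t₀ a) (σ a * p) = H (e b) (t₀ b) (σ b * -p))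
    (hΩ : ∀ a, ∀ s ∈ Icc 0 r, G.π (e a) (t₀ a + σ a * s) ∈ Ω ∧
      f (G.π (e a) (t₀ a + σ a * s)) ≤ -η)
    (hsub0 : ∀ a, ∀ φ : EuclideanSpace ℝ (Fin N) → ℝ, ∀ p, ContinuousOn φ G.Gam →
      HasDerivWithinAt (fun s => φ (G.π (e a) (t₀ a + σ a * s))) (-p) (Ici 0) 0 →
      (∀ b, b ≠ a → HasDerivWithinAt (fun s => φ (G.π (e b) (t₀ b + σ b * s))) p (Ici 0) 0) →
      IsLocalMaxOn (fun y => u y - φ y) G.Gam x₀ → H (e a) (t₀ a) (σ a * -p) ≤ f x₀)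
    (hsup0 : ∀ a, ∀ φ : EuclideanSpace ℝ (Fin N) → ℝ, ∀ p, ContinuousOn φ G.Gam →
      HasDerivWithinAt (fun s => φ (G.π (e a) (t₀ a + σ a * s))) (-p) (Ici 0) 0 →
      (∀ b, b ≠ a → HasDerivWithinAt (fun s => φ (G.π (e b) (t₀ b + σ b * s))) p (Ici 0) 0) →
      IsLocalMinOn (fun y => v y - φ y) G.Gam x₀ → 0 ≤ H (e a) (t₀ a) (σ a * -p)) :
    False := by
  have hGam : G.Gam ⊆ G.Gbar := sdiff_subset
  have hσσ : ∀ a, σ a * σ a = 1 := fun a => by rcases hσ a with h | h <;> rw [h] <;> norm_num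
  have hIcc : ∀ a, ∀ s ∈ Icc 0 r, t₀ a + σ a * s ∈ Icc 0 (G.l (e a)) := by
    intro a s hs
    rcases hs.1.eq_or_lt with h | h
    · rw [← h, mul_zero, add_zero]
      exact ht₀ a
    · exact Ioo_subset_Icc_self (hIoo a s ⟨h, hs.2⟩)
  have hmaps : ∀ a, MapsTo (fun s => t₀ a + σ a * s) (Icc 0 r) (Icc 0 (G.l (e a))) := hIcc
  have hray : ∀ a, ContinuousOn (fun s => G.π (e a) (t₀ a + σ a * s)) (Icc 0 r) := fun a =>
    (G.continuousOn_π (e a)).comp (by fun_prop) (hmaps a)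
  have hrayG : ∀ a, MapsTo (fun s => G.π (e a) (t₀ a + σ a * s)) (Icc 0 r) G.Gbar :=
    fun a s hs => G.π_mem_Gbar (hIcc a s hs)
  have hcentre : ∀ a, G.π (e a) (t₀ a + σ a * 0) = x₀ := fun a => by
    rw [mul_zero, add_zero, hx₀]
  have h0r : (0 : ℝ) ∈ Icc 0 r := ⟨le_rfl, hr.le⟩
  have hIccev : ∀ᶠ s in 𝓝[≥] (0 : ℝ), s ∈ Icc 0 r := Icc_mem_nhdsGE hr
  -- test functions at a point inside a ray
  have hint : ∀ a, ∀ s ∈ Ioo 0 r, ∀ g : ℝ → ℝ, ∀ p, Continuous g → HasDerivAt g p s →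
      ∃ φ : EuclideanSpace ℝ (Fin N) → ℝ, ContinuousOn φ G.Gam ∧
        G.HasEdgeDerivAt φ (e a) (t₀ a + σ a * s) (σ a * p) ∧
        φ (G.π (e a) (t₀ a + σ a * s)) = g s ∧
        ∀ Q : EuclideanSpace ℝ (Fin N) → ℝ → Prop,
          (∀ᶠ s' in 𝓝 s, Q (G.π (e a) (t₀ a + σ a * s')) (g s')) →
          ∀ᶠ y in 𝓝[G.Gam] (G.π (e a) (t₀ a + σ a * s)), Q y (φ y) := by
    intro a s hs g p hg hgp
    obtain ⟨ρ, hρc, hρ⟩ := hρ a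
    have hval : ∀ s' ∈ Icc 0 r, g (-ρ (G.π (e a) (t₀ a + σ a * s'))) = g s' := fun s' hs' => by
      rw [(hρ s' hs').1, neg_neg]
    have hinv : ∀ t, t₀ a + σ a * (σ a * (t - t₀ a)) = t := fun t => by
      rw [← mul_assoc, hσσ, one_mul]
      ring
    have hinv' : σ a * (t₀ a + σ a * s - t₀ a) = s := by
      rw [add_sub_cancel_left, ← mul_assoc, hσσ, one_mul]
    have htend : Tendsto (fun t => σ a * (t - t₀ a)) (𝓝 (t₀ a + σ a * s)) (𝓝 s) := by
      have : Continuous (fun t => σ a * (t - t₀ a)) := by fun_prop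
      have := this.tendsto (t₀ a + σ a * s)
      rwa [hinv'] at this
    have hIccs : ∀ᶠ s' in 𝓝 s, s' ∈ Icc 0 r := Icc_mem_nhds hs.1 hs.2
    refine ⟨fun y => g (-ρ y), hg.comp_continuousOn (hρc.mono hGam).neg, ?_,
      hval s (Ioo_subset_Icc_self hs), fun Q hQ => ?_⟩
    · have hd : HasDerivAt (fun t => g (σ a * (t - t₀ a))) (p * (σ a * 1)) (t₀ a + σ a * s) := by
        refine HasDerivAt.comp (t₀ a + σ a * s) (h₂ := g) ?_
          (((hasDerivAt_id _).sub_const _).const_mul _)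
        simpa only [id, hinv'] using hgp
      have hd' := hd.congr_of_eventuallyEq (f₁ := fun t => g (-ρ (G.π (e a) t))) (by
        filter_upwards [htend.eventually hIccs] with t ht
        have := hval _ ht
        rwa [hinv] at this)
      refine (hd'.congr_deriv ?_).hasDerivWithinAt
      ring
    · refine nhdsWithin_mono _ hGam (G.eventually_nhdsWithin_Gbar fun j t ht hjt => ?_)
      obtain ⟨rfl, rfl⟩ := G.edge_unique (hIoo a s ⟨hs.1, hs.2.le⟩) ht hjt
      refine nhdsWithin_le_nhds ?_
      filter_upwards [htend.eventually hIccs, htend.eventually hQ] with t h1 h2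
      have h3 := hval _ h1
      rw [hinv] at h2 h3
      simp only [h3]
      exact h2
  -- test functions at the centre
  have hcen : ∀ a, ∀ g : ℝ → ℝ, ∀ p, Continuous g → HasDerivAt g p 0 →
      ∃ φ : EuclideanSpace ℝ (Fin N) → ℝ, ContinuousOn φ G.Gam ∧ φ x₀ = g 0 ∧
        HasDerivWithinAt (fun s => φ (G.π (e a) (t₀ a + σ a * s))) (-p) (Ici 0) 0 ∧
        (∀ b, b ≠ a → HasDerivWithinAt (fun s => φ (G.π (e b) (t₀ b + σ b * s))) p (Ici 0) 0) ∧
        ∀ Q : EuclideanSpace ℝ (Fin N) → ℝ → Prop,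
          (∀ᶠ s in 𝓝[≥] 0, Q (G.π (e a) (t₀ a + σ a * s)) (g (-s))) →
          (∀ b, b ≠ a → ∀ᶠ s in 𝓝[≥] 0, Q (G.π (e b) (t₀ b + σ b * s)) (g s)) →
          ∀ᶠ y in 𝓝[G.Gam] x₀, Q y (φ y) := by
    intro a g p hg hgp
    obtain ⟨ρ, hρc, hρ⟩ := hρ a
    have hρ0 : ρ x₀ = 0 := by
      have := (hρ 0 h0r).1
      rwa [hcentre, neg_zero] at this
    have hown : ∀ᶠ s in 𝓝[≥] 0, g (ρ (G.π (e a) (t₀ a + σ a * s))) = g (-s) :=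
      hIccev.mono fun s hs => by rw [(hρ s hs).1]
    have hother : ∀ b, b ≠ a → ∀ᶠ s in 𝓝[≥] 0, g (ρ (G.π (e b) (t₀ b + σ b * s))) = g s :=
      fun b hb => hIccev.mono fun s hs => by rw [(hρ s hs).2 b hb]
    refine ⟨fun y => g (ρ y), hg.comp_continuousOn (hρc.mono hGam), by simp only [hρ0], ?_, ?_, ?_⟩
    · have hd : HasDerivAt (fun s => g (-s)) (p * -1) 0 := by
        refine HasDerivAt.comp (0 : ℝ) (h₂ := g) ?_ (hasDerivAt_neg 0)
        simpa using hgp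
      have hd' := hd.hasDerivWithinAt.congr_of_eventuallyEq (s := Ici 0) hown
        (hown.self_of_nhdsWithin self_mem_Ici)
      simpa using hd'
    · intro b hb
      exact hgp.hasDerivWithinAt.congr_of_eventuallyEq (s := Ici 0) (hother b hb)
        ((hother b hb).self_of_nhdsWithin self_mem_Ici)
    · intro Q hQ hQ'
      refine nhdsWithin_mono _ hGam (hnb _ fun b => ?_)
      by_cases hb : b = a
      · subst hb
        filter_upwards [hQ, hown] with s h1 h2
        rwa [h2]
      · filter_upwards [hQ' b hb, hother b hb] with s h1 h2
        rwa [h2]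
  refine _root_.star_comparison (h := fun a s p => H (e a) (t₀ a + σ a * s) (σ a * p))
    (u := fun a s => u (G.π (e a) (t₀ a + σ a * s)))
    (v := fun a s => v (G.π (e a) (t₀ a + σ a * s)))
    (u₀ := u x₀) (v₀ := v x₀) hr hη ?_ ?_ ?_ ?_ ?_ ?_ ?_ ?_ ?_ ?_ ?_ ?_ ?_
  · intro a
    exact (hH.cont (e a)).comp (f := fun q : ℝ × ℝ => (t₀ a + σ a * q.1, σ a * q.2))
      (by fun_prop) (fun q hq => ⟨hIcc a q.1 hq.1, mem_univ _⟩)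
  · intro a s hs
    exact (hH.cvx (e a) _ (hIcc a s hs)).comp_linearMap (LinearMap.mul ℝ ℝ (σ a))
  · intro a C
    have hco := hH.coercive (e a) (t₀ a) (ht₀ a)
    rw [cocompact_eq_atBot_atTop, tendsto_sup] at hco
    have h1 := hco.2.eventually (eventually_gt_atTop C)
    have h2 := (hco.1.comp tendsto_neg_atTop_atBot).eventually (eventually_gt_atTop C)
    obtain ⟨R, h1, h2, hR⟩ := (h1.and (h2.and (eventually_gt_atTop 0))).exists
    refine ⟨R, hR, ?_⟩
    simp only [mul_zero, add_zero]
    rcases hσ a with h | h <;> rw [h] <;> simpa using by tauto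
  · intro a b hab p
    simpa using hcomp a b hab p
  · exact fun a => hu.1.comp (hray a) (hrayG a)
  · exact fun a => hv.1.comp (hray a) (hrayG a)
  · exact fun a => congrArg u (hcentre a)
  · exact fun a => congrArg v (hcentre a)
  · exact fun a s hs => hmax _ (hrayG a hs)
  · intro a s hs g p hg hgp hloc
    obtain ⟨φ, hφ, hφd, hφs, hφQ⟩ := hint a s hs g p hg hgp
    have hs' := Ioo_subset_Icc_self hs
    have h2 := hφQ
      (fun y c => u y - c ≤ u (G.π (e a) (t₀ a + σ a * s)) - g s) hloc
    refine (hu.2.1 (e a) _ (hIoo a s ⟨hs.1, hs.2.le⟩) (hΩ a s hs').1 φ hφ _ hφd ?_).trans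
      (hΩ a s hs').2
    rw [IsLocalMaxOn, IsMaxFilter, hφs]
    exact h2
  · intro a g p hg hgp hown hother
    obtain ⟨φ, hφ, hφ0, hφa, hφb, hφQ⟩ := hcen a g p hg hgp
    have := hsub0 a φ p hφ hφa hφb (by
      rw [IsLocalMaxOn, IsMaxFilter, hφ0]
      exact hφQ (fun y c => u y - c ≤ u x₀ - g 0) hown hother)
    have h2 := (hΩ a 0 h0r).2
    rw [hcentre] at h2
    simpa using this.trans h2
  · intro a s hs g p hg hgp hloc
    obtain ⟨φ, hφ, hφd, hφs, hφQ⟩ := hint a s hs g p hg hgp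
    have hs' := Ioo_subset_Icc_self hs
    have h2 := hφQ
      (fun y c => v (G.π (e a) (t₀ a + σ a * s)) - g s ≤ v y - c) hloc
    refine hv.2.1 (e a) _ (hIoo a s ⟨hs.1, hs.2.le⟩) (hΩ a s hs').1 φ hφ _ hφd ?_
    rw [IsLocalMinOn, IsMinFilter, hφs]
    exact h2
  · intro a g p hg hgp hown hother
    obtain ⟨φ, hφ, hφ0, hφa, hφb, hφQ⟩ := hcen a g p hg hgp
    have := hsup0 a φ p hφ hφa hφb (by
      rw [IsLocalMinOn, IsMinFilter, hφ0]
      exact hφQ (fun y c => v x₀ - g 0 ≤ v y - c) hown hother)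
    simpa using this

theorem hasEdgeDerivAt_of_ray {φ : EuclideanSpace ℝ (Fin N) → ℝ} {i : I} {j : J}
    (hj : j ∈ G.Inc i) {p : ℝ}
    (h : HasDerivWithinAt (fun s => φ (G.π j (G.vt i j + G.a i j * s))) p (Ici 0) 0) :
    G.HasEdgeDerivAt φ j (G.vt i j) (G.a i j * p) := by
  have haa : G.a i j * G.a i j = 1 := by
    rcases G.inc_cases hj with ⟨-, h, -⟩ | ⟨-, h, -⟩ <;> rw [h] <;> norm_num
  have hm : MapsTo (fun t => G.a i j * (t - G.vt i j)) (Icc 0 (G.l j)) (Ici 0) := by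
    intro t ht
    rcases G.inc_cases hj with ⟨h1, h2, -⟩ | ⟨h1, h2, -⟩ <;> simp only [h1, h2, mem_Ici] <;>
      linarith [ht.1, ht.2]
  have hd : HasDerivWithinAt (fun t => G.a i j * (t - G.vt i j)) (G.a i j * 1)
      (Icc 0 (G.l j)) (G.vt i j) :=
    (((hasDerivAt_id _).sub_const _).const_mul _).hasDerivWithinAt
  have := HasDerivWithinAt.comp (G.vt i j) (h := fun t => G.a i j * (t - G.vt i j))
    (h₂ := fun s => φ (G.π j (G.vt i j + G.a i j * s))) (by simpa using h) hd hm
  have hfun : (fun s => φ (G.π j (G.vt i j + G.a i j * s))) ∘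
      (fun t => G.a i j * (t - G.vt i j)) = fun t => φ (G.π j t) := by
    funext t
    simp only [Function.comp]
    rw [← mul_assoc, haa, one_mul, add_sub_cancel]
  rw [hfun] at this
  exact this.congr_deriv (by ring)

open Classical in
/-- `u - v` has no maximum over the network at a transition vertex at which the equations hold and
`f` is negative. -/
theorem not_max_at_vertex {H : J → ℝ → ℝ → ℝ} (hH : G.IsEikonalHamiltonian H)
    {f u v : EuclideanSpace ℝ (Fin N) → ℝ} {Ω : Set (EuclideanSpace ℝ (Fin N))}
    (hu : G.IsSubSolOn H f u Ω) (hv : G.IsSuperSolOn H (fun _ => (0 : ℝ)) v Ω)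
    {i : I} (hi : i ∈ G.IT) (hmax : ∀ x ∈ G.Gbar, u x - v x ≤ u (G.V i) - v (G.V i))
    {η : ℝ} (hη : 0 < η) (hΩ : ∀ᶠ y in 𝓝[G.Gbar] (G.V i), y ∈ Ω ∧ f y ≤ -η)
    (hiΩ : G.V i ∈ Ω) : False := by
  obtain ⟨j₀, hj₀⟩ := G.exists_inc_of_vertex i
  have : Nonempty (G.Inc i) := ⟨⟨j₀, hj₀⟩⟩
  have hvt : ∀ a : G.Inc i, G.vt i a ∈ Icc 0 (G.l a) := by
    intro a
    rcases G.inc_cases a.2 with ⟨h, -, -⟩ | ⟨h, -, -⟩ <;> rw [h] <;> simp [(G.l_pos a).le]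
  have hV : ∀ a : G.Inc i, G.π a (G.vt i a) = G.V i := by
    intro a
    rcases G.inc_cases a.2 with ⟨h, -, h'⟩ | ⟨h, -, h'⟩ <;> rw [h, h']
  have hσ : ∀ a : G.Inc i, G.a i a = 1 ∨ G.a i a = -1 := fun a => by
    rcases G.inc_cases a.2 with ⟨-, h, -⟩ | ⟨-, h, -⟩ <;> simp [h]
  have hσσ : ∀ a : G.Inc i, G.a i a * G.a i a = 1 := fun a => by
    rcases hσ a with h | h <;> rw [h] <;> norm_num
  have hev : ∀ᶠ s in 𝓝[≥] (0 : ℝ), ∀ a : G.Inc i, s < G.l a / 2 ∧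
      G.π a (G.vt i a + G.a i a * s) ∈ Ω ∧ f (G.π a (G.vt i a + G.a i a * s)) ≤ -η := by
    rw [eventually_all]
    intro a
    have hla := G.l_pos a
    have hlt : ∀ᶠ s in 𝓝[≥] (0 : ℝ), s < G.l a / 2 :=
      nhdsWithin_le_nhds (Iio_mem_nhds (by linarith))
    have hray : Tendsto (fun s => G.vt i a + G.a i a * s) (𝓝[≥] 0)
        (𝓝[Icc 0 (G.l a)] (G.vt i a)) := by
      refine tendsto_nhdsWithin_iff.2 ⟨?_, ?_⟩
      · have hc : Continuous (fun s => G.vt i a + G.a i a * s) := by fun_prop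
        have := hc.tendsto 0
        rw [mul_zero, add_zero] at this
        exact this.mono_left nhdsWithin_le_nhds
      · filter_upwards [hlt, self_mem_nhdsWithin] with s h1 h2
        rw [mem_Ici] at h2
        rcases G.inc_cases a.2 with ⟨h3, h4, -⟩ | ⟨h3, h4, -⟩ <;> rw [h3, h4, mem_Icc] <;>
          constructor <;> linarith
    have h2 := (G.tendsto_π (hvt a)).comp hray
    rw [hV] at h2
    filter_upwards [hlt, h2.eventually hΩ] with s h3 h4 using ⟨h3, h4⟩
  obtain ⟨r, hr, hr'⟩ := mem_nhdsGE_iff_exists_Icc_subset.1 hev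
  refine G.star_comparison hH hu hv hmax (e := fun a : G.Inc i => (a : J))
    (t₀ := fun a => G.vt i a) (σ := fun a => G.a i a) (r := r) hr hη hσ hvt hV ?_ ?_ ?_ ?_ ?_ ?_ ?_
  · intro a s hs
    have h1 := (hr' (Ioc_subset_Icc_self hs) a).1
    have h2 := hs.1
    rcases G.inc_cases a.2 with ⟨h3, h4, -⟩ | ⟨h3, h4, -⟩ <;> rw [h3, h4, mem_Ioo] <;>
      constructor <;> linarith
  · intro a
    obtain ⟨ρ, hρ, hρ'⟩ := G.exists_glue
      (g := fun k t => (if k = (a : J) then -1 else 1) * min t (G.l k - t))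
      (fun k => by fun_prop) (fun k => by simp [(G.l_pos k).le])
      (fun k => by simp [(G.l_pos k).le])
    have hval : ∀ s ∈ Icc 0 r, ∀ b : G.Inc i, ρ (G.π b (G.vt i b + G.a i b * s)) =
        (if (b : J) = (a : J) then -1 else 1) * s := by
      intro s hs b
      have h1 := (hr' hs b).1
      have h2 := hs.1
      have hmem : G.vt i b + G.a i b * s ∈ Icc 0 (G.l b) := by
        rcases G.inc_cases b.2 with ⟨h3, h4, -⟩ | ⟨h3, h4, -⟩ <;> rw [h3, h4, mem_Icc] <;>
          constructor <;> linarith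
      rw [hρ' b _ hmem]
      congr 1
      rcases G.inc_cases b.2 with ⟨h3, h4, -⟩ | ⟨h3, h4, -⟩ <;> rw [h3, h4]
      · rw [min_eq_left] <;> linarith
      · rw [min_eq_right] <;> linarith
    refine ⟨ρ, hρ, fun s hs => ⟨?_, fun b hb => ?_⟩⟩
    · rw [hval s hs a, if_pos rfl, neg_one_mul]
    · rw [hval s hs b, if_neg (fun h => hb (Subtype.ext h)), one_mul]
  · intro P hP
    refine G.eventually_nhdsWithin_Gbar fun j t ht hjt => ?_
    obtain ⟨hj, rfl⟩ := G.inc_of_π_eq ht hjt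
    have htend : Tendsto (fun t => G.a i j * (t - G.vt i j)) (𝓝[Icc 0 (G.l j)] (G.vt i j))
        (𝓝[≥] 0) := by
      refine tendsto_nhdsWithin_iff.2 ⟨?_, ?_⟩
      · have hc : Continuous (fun t => G.a i j * (t - G.vt i j)) := by fun_prop
        have := hc.tendsto (G.vt i j)
        rw [sub_self, mul_zero] at this
        exact this.mono_left nhdsWithin_le_nhds
      · filter_upwards [self_mem_nhdsWithin] with t ht
        rcases G.inc_cases hj with ⟨h1, h2, -⟩ | ⟨h1, h2, -⟩ <;> rw [h1, h2, mem_Ici] <;>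
          linarith [ht.1, ht.2]
    filter_upwards [htend.eventually (hP ⟨j, hj⟩)] with t ht
    rwa [← mul_assoc, hσσ ⟨j, hj⟩, one_mul, add_sub_cancel] at ht
  · intro a b _ p
    have hs : ∀ (c : G.Inc i) (q : ℝ), H c (G.vt i c) (G.a i c * q) = H c (G.vt i c) q := by
      intro c q
      rcases hσ c with h | h <;> rw [h]
      · rw [one_mul]
      · rw [neg_one_mul, ← hH.vertexSymm i c c.2]
    rw [hs, hs, ← hH.vertexSymm i b b.2]
    exact hH.vertexCompat i a a.2 b b.2 p
  · exact fun a s hs => (hr' hs a).2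
  · intro a φ p hφ hφa hφb hloc
    obtain ⟨k, hk, hka⟩ := G.exists_inc_ne hi a.2
    refine hu.2.2 i hi hiΩ a a.2 k hk (Ne.symm hka) φ hφ _ _ (G.hasEdgeDerivAt_of_ray a.2 hφa)
      (G.hasEdgeDerivAt_of_ray hk (hφb ⟨k, hk⟩ fun h => hka (congrArg Subtype.val h))) ?_ hloc
    have h1 := hσσ a
    have h2 := hσσ ⟨k, hk⟩
    simp only at h2
    linear_combination (-p) * h1 + p * h2
  · intro a φ p hφ hφa hφb hloc
    obtain ⟨k, hk, hka, hk'⟩ := hv.2.2 i hi hiΩ a a.2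
    refine hk' φ hφ _ _ (G.hasEdgeDerivAt_of_ray a.2 hφa)
      (G.hasEdgeDerivAt_of_ray hk (hφb ⟨k, hk⟩ fun h => hka (congrArg Subtype.val h))) ?_ hloc
    have h1 := hσσ a
    have h2 := hσσ ⟨k, hk⟩
    simp only at h2
    linear_combination (-p) * h1 + p * h2

/-- `u - v` has no maximum over the network at a point of an open edge near which the equations
hold and `f` is bounded away from zero. -/
theorem not_max_in_edge {H : J → ℝ → ℝ → ℝ} (hH : G.IsEikonalHamiltonian H)
    {f u v : EuclideanSpace ℝ (Fin N) → ℝ} {Ω : Set (EuclideanSpace ℝ (Fin N))}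
    (hu : G.IsSubSolOn H f u Ω) (hv : G.IsSuperSolOn H (fun _ => (0 : ℝ)) v Ω)
    {j : J} {t : ℝ} (ht : t ∈ Ioo 0 (G.l j))
    (hmax : ∀ x ∈ G.Gbar, u x - v x ≤ u (G.π j t) - v (G.π j t))
    {η : ℝ} (hη : 0 < η) (hΩ : ∀ᶠ y in 𝓝[G.Gbar] (G.π j t), y ∈ Ω ∧ f y ≤ -η)
    (htΩ : G.π j t ∈ Ω) : False := by
  classical
  let σ : Bool → ℝ := fun a => if a then 1 else -1
  have hσ : ∀ a, σ a = 1 ∨ σ a = -1 := by simp [σ]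
  have hop : ∀ a b, b ≠ a → σ b = -σ a := by simp [σ]
  have htI := Ioo_subset_Icc_self ht
  have hev : ∀ᶠ s in 𝓝[≥] (0 : ℝ), ∀ a : Bool, s < min t (G.l j - t) / 2 ∧
      G.π j (t + σ a * s) ∈ Ω ∧ f (G.π j (t + σ a * s)) ≤ -η := by
    rw [eventually_all]
    intro a
    have hpos : 0 < min t (G.l j - t) := lt_min ht.1 (sub_pos.2 ht.2)
    have hc : Tendsto (fun s => t + σ a * s) (𝓝[≥] 0) (𝓝 t) := by
      have hc : Continuous (fun s => t + σ a * s) := by fun_prop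
      have := hc.tendsto 0
      rw [mul_zero, add_zero] at this
      exact this.mono_left nhdsWithin_le_nhds
    have h2 := G.tendsto_π htI
    rw [nhdsWithin_eq_nhds.2 (Icc_mem_nhds ht.1 ht.2)] at h2
    have h1 : ∀ᶠ s in 𝓝[≥] (0 : ℝ), s < min t (G.l j - t) / 2 :=
      nhdsWithin_le_nhds (Iio_mem_nhds (by linarith))
    filter_upwards [h1, (h2.comp hc).eventually hΩ] with s h3 h4 using ⟨h3, h4⟩
  obtain ⟨r, hr, hr'⟩ := mem_nhdsGE_iff_exists_Icc_subset.1 hev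
  have hsmall : ∀ s ∈ Icc 0 r, s < t / 2 ∧ s < (G.l j - t) / 2 := fun s hs => by
    have h := (hr' hs true).1
    exact ⟨by linarith [min_le_left t (G.l j - t)], by linarith [min_le_right t (G.l j - t)]⟩
  have hIoo : ∀ a, ∀ s ∈ Icc 0 r, t + σ a * s ∈ Ioo 0 (G.l j) := by
    intro a s hs
    obtain ⟨h1, h2⟩ := hsmall s hs
    have := hs.1
    rcases hσ a with h | h <;> rw [h, mem_Ioo] <;> constructor <;> linarith [ht.1, ht.2]
  have htwo : ∀ {φ : EuclideanSpace ℝ (Fin N) → ℝ} {a : Bool} {p : ℝ},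
      HasDerivWithinAt (fun s => φ (G.π j (t + σ a * s))) (-p) (Ici 0) 0 →
      (∀ b, b ≠ a → HasDerivWithinAt (fun s => φ (G.π j (t + σ b * s))) p (Ici 0) 0) →
      G.HasEdgeDerivAt φ j t (σ a * -p) := by
    intro φ a p ha hb
    have hside : ∀ (τ : ℝ) (q : ℝ), τ * τ = 1 →
        HasDerivWithinAt (fun s => φ (G.π j (t + τ * s))) q (Ici 0) 0 →
        HasDerivWithinAt (fun s => φ (G.π j s)) (τ * q) {s | 0 ≤ τ * (s - t)} t := by
      intro τ q hτ h
      have hd : HasDerivWithinAt (fun s => τ * (s - t)) (τ * 1) {s | 0 ≤ τ * (s - t)} t :=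
        (((hasDerivAt_id _).sub_const _).const_mul _).hasDerivWithinAt
      have := HasDerivWithinAt.comp t (h := fun s => τ * (s - t))
        (h₂ := fun s => φ (G.π j (t + τ * s))) (s' := Ici 0)
        (by simpa only [sub_self, mul_zero] using h) hd (fun s hs => hs)
      have hfun : (fun s => φ (G.π j (t + τ * s))) ∘ (fun s => τ * (s - t)) =
          fun s => φ (G.π j s) := by
        funext s
        simp only [Function.comp]
        rw [← mul_assoc, hτ, one_mul, add_sub_cancel]
      rw [hfun] at this
      exact this.congr_deriv (by ring)
    have hσσ : ∀ a, σ a * σ a = 1 := fun a => by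
      rcases hσ a with h | h <;> rw [h] <;> norm_num
    have h1 := hside _ _ (hσσ a) ha
    have h2 := hside _ _ (hσσ !a) (hb (!a) (by simp))
    rw [hop a _ (by simp), show -σ a * p = σ a * -p by ring] at h2
    refine (h1.union h2).mono fun s _ => ?_
    simp only [mem_union, mem_ofPred_eq]
    rcases le_total 0 (σ a * (s - t)) with h | h
    · exact Or.inl h
    · exact Or.inr (by linarith)
  refine G.star_comparison hH hu hv hmax (A := Bool) (e := fun _ => j)
    (t₀ := fun _ => t) (σ := σ) (r := r) hr hη hσ (fun _ => htI) (fun _ => rfl)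
    (fun a s hs => hIoo a s (Ioc_subset_Icc_self hs)) ?_ ?_ ?_ ?_ ?_ ?_
  · intro a
    obtain ⟨ρ, hρ, hρ'⟩ := G.exists_glue
      (g := fun k x => if k = j then
        -σ a * max (-(min x (G.l k - x))) (min (x - t) (min x (G.l k - x))) else 0)
      (fun k => by
        by_cases h : k = j
        · simp only [h, if_true]
          fun_prop
        · simp only [h, if_false]
          fun_prop)
      (fun k => by
        by_cases h : k = j
        · subst h
          simp [(G.l_pos k).le, ht.1.le]
        · simp [h])
      (fun k => by
        by_cases h : k = j
        · subst h
          simp [(G.l_pos k).le, ht.2.le]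
        · simp [h])
    have hval : ∀ s ∈ Icc 0 r, ∀ b, ρ (G.π j (t + σ b * s)) = -σ a * (σ b * s) := by
      intro s hs b
      rw [hρ' j _ (Ioo_subset_Icc_self (hIoo b s hs)), if_pos rfl]
      congr 1
      obtain ⟨h1, h2⟩ := hsmall s hs
      have h3 := hs.1
      have hm : s ≤ min (t + σ b * s) (G.l j - (t + σ b * s)) := by
        refine le_min ?_ ?_ <;> rcases hσ b with h | h <;> rw [h] <;> linarith
      have hb : -s ≤ σ b * s ∧ σ b * s ≤ s := by
        rcases hσ b with h | h <;> rw [h] <;> constructor <;> linarith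
      rw [add_sub_cancel_left, min_eq_left (hb.2.trans hm),
        max_eq_right ((neg_le_neg hm).trans hb.1)]
    refine ⟨ρ, hρ, fun s hs => ⟨?_, fun b hb => ?_⟩⟩
    · rw [hval s hs a]
      rcases hσ a with h | h <;> rw [h] <;> ring
    · rw [hval s hs b]
      rw [hop a b hb]
      rcases hσ a with h | h <;> rw [h] <;> ring
  · intro P hP
    refine G.eventually_nhdsWithin_Gbar fun k x hx hkx => ?_
    obtain ⟨rfl, rfl⟩ := G.edge_unique ht hx hkx
    refine nhdsWithin_le_nhds ?_
    have hc : ∀ a, Tendsto (fun y => σ a * (y - x)) (𝓝 x) (𝓝 0) := by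
      intro a
      have hc : Continuous (fun y => σ a * (y - x)) := by fun_prop
      have := hc.tendsto x
      rwa [sub_self, mul_zero] at this
    have h1 := (hc true).eventually (eventually_nhdsWithin_iff.1 (hP true))
    have h2 := (hc false).eventually (eventually_nhdsWithin_iff.1 (hP false))
    filter_upwards [h1, h2] with y hy1 hy2
    rcases le_total x y with h | h
    · simpa [σ] using hy1 (by simpa [σ] using h)
    · simpa [σ] using hy2 (by simpa [σ] using h)
  · intro a b hab p
    rw [hop a b hab.symm, neg_mul_neg]
  · exact fun a s hs => (hr' hs a).2
  · exact fun a φ p hφ hφa hφb hloc => hu.2.1 j t ht htΩ φ hφ _ (htwo hφa hφb) hloc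
  · exact fun a φ p hφ hφa hφb hloc => hv.2.1 j t ht htΩ φ hφ _ (htwo hφa hφb) hloc

end TopNetwork

/-- Comparison theorem: let `K ⊆ Γ` be closed and let `f` be
continuous on `Γ` with `f < 0` on `Γ \ K`.  If `u` is a viscosity subsolution of
`H(x, Du) = f(x)` in `Γ \ K` and `v` is a viscosity supersolution of `H(x, Du) = 0`
in `Γ \ K`, and `u ≤ v` on `∂Γ ∪ K`, then `u ≤ v` on all of `Γ̄`. -/
theorem comparison_theorem
    {N : ℕ} {I J : Type} [Fintype I] [Fintype J] (G : TopNetwork N I J)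
    (H : J → ℝ → ℝ → ℝ) (hH : G.IsEikonalHamiltonian H)
    (K : Set (EuclideanSpace ℝ (Fin N))) (hKsub : K ⊆ G.Gam) (hKcl : IsClosed K)
    (f : EuclideanSpace ℝ (Fin N) → ℝ) (hf : ContinuousOn f G.Gam)
    (hfneg : ∀ x ∈ G.Gam \ K, f x < 0)
    (u v : EuclideanSpace ℝ (Fin N) → ℝ)
    (hu : G.IsSubSolOn H f u (G.Gam \ K))
    (hv : G.IsSuperSolOn H (fun _ => (0 : ℝ)) v (G.Gam \ K))
    (hbd : ∀ x ∈ G.bdry ∪ K, u x ≤ v x) :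
    ∀ x ∈ G.Gbar, u x ≤ v x := by
  by_contra! hcon
  obtain ⟨x₁, hx₁, hlt⟩ := hcon
  have husc : UpperSemicontinuousOn (fun x => u x + -v x) G.Gbar := hu.1.add hv.1.neg
  obtain ⟨x₀, hx₀, hmax'⟩ := husc.exists_isMaxOn ⟨x₁, hx₁⟩ G.isCompact_Gbar
  have hmax : ∀ x ∈ G.Gbar, u x - v x ≤ u x₀ - v x₀ := fun x hx => by
    simpa [sub_eq_add_neg] using hmax' hx
  have hpos : v x₀ < u x₀ := by linarith [hmax x₁ hx₁]
  have hx₀bd : x₀ ∉ G.bdry ∪ K := fun h => absurd (hbd x₀ h) (not_le.2 hpos)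
  have hx₀Gam : x₀ ∈ G.Gam := ⟨hx₀, fun h => hx₀bd (Or.inl h)⟩
  have hx₀Ω : x₀ ∈ G.Gam \ K := ⟨hx₀Gam, fun h => hx₀bd (Or.inr h)⟩
  have hopen : ∀ᶠ y in 𝓝[G.Gbar] x₀, y ∈ G.Gam \ K := by
    have h1 : ∀ᶠ y in 𝓝[G.Gbar] x₀, y ∈ (G.bdry ∪ K)ᶜ :=
      nhdsWithin_le_nhds ((G.isClosed_bdry.union hKcl).isOpen_compl.mem_nhds hx₀bd)
    filter_upwards [h1, self_mem_nhdsWithin] with y h2 h3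
    exact ⟨⟨h3, fun h => h2 (Or.inl h)⟩, fun h => h2 (Or.inr h)⟩
  have hf₀ := hfneg x₀ hx₀Ω
  have hfev : ∀ᶠ y in 𝓝[G.Gbar] x₀, y ∈ G.Gam \ K ∧ f y ≤ -(-f x₀ / 2) := by
    have h1 := (hf x₀ hx₀Gam).eventually_lt_const (show f x₀ < f x₀ / 2 by linarith)
    rw [eventually_nhdsWithin_iff] at h1
    filter_upwards [hopen, nhdsWithin_le_nhds h1] with y hy h2
    exact ⟨hy, by linarith [h2 hy.1]⟩
  have hη : 0 < -f x₀ / 2 := by linarith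
  rcases G.Gbar_cases hx₀ with ⟨i, rfl⟩ | ⟨j, t, ht, rfl⟩
  · exact G.not_max_at_vertex hH hu hv (fun h => hx₀Gam.2 ⟨i, h, rfl⟩) hmax hη hfev hx₀Ω
  · exact G.not_max_in_edge hH hu hv ht hmax hη hfev hx₀Ω
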